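/- Let a ∈ (0,1) be a real number. Then ∑_{n=1}^{∞} L( a²(1/2 - a/2)^n (1/2 + a/2)^n / ((1/2 + a/2)^{n+1} - (1/2 - a/2)^{n+1})² ) = L((1-a)/(1+a)). -/

import Mathlib

/-- The Rogers dilogarithm on `[0,1]`: `L(x) = Li₂(x) + (1/2)·log x · log (1-x)`
for `0 < x < 1`, with `L 0 = 0` and `L 1 = π²/6`. -/
noncomputable def rogersL (x : ℝ) : ℝ :=
  if x = 0 then 0
  else if x = 1 then Real.pi ^ 2 / 6
  else (∑' n : ℕ, x ^ (n + 1) / ((n : ℝ) + 1) ^ 2) + 1 / 2 * Real.log x * Real.log (1 - x)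

open Set Filter Topology

theorem summable_one_div_succ_sq : Summable fun n : ℕ => 1 / ((n : ℝ) + 1) ^ 2 := by
  have h := (summable_nat_add_iff 1).2 (Real.summable_one_div_nat_pow (p := 2).2 one_lt_two)
  simpa using h

theorem tsum_one_div_succ_sq : ∑' n : ℕ, 1 / ((n : ℝ) + 1) ^ 2 = Real.pi ^ 2 / 6 := by
  have h := (hasSum_nat_add_iff' 1).2 hasSum_zeta_two
  simpa using h.tsum_eq

/-- The closed formula for `rogersL` also gives its values at `0` and `1`, as `Real.log 0 = 0`. -/
theorem rogersL_eq (x : ℝ) :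
    rogersL x = (∑' n : ℕ, x ^ (n + 1) / ((n : ℝ) + 1) ^ 2) +
      1 / 2 * (Real.log x * Real.log (1 - x)) := by
  unfold rogersL
  split_ifs with h0 h1
  · simp [h0]
  · simp only [h1, one_pow, tsum_one_div_succ_sq]
    simp
  · ring

theorem continuous_log_mul_log_one_sub_at_zero :
    ContinuousAt (fun x : ℝ => Real.log x * Real.log (1 - x)) 0 := by
  have hd : DifferentiableAt ℝ (fun x : ℝ => Real.log (1 - x)) 0 :=
    DifferentiableAt.log (by fun_prop) (by norm_num)
  have h := Real.continuous_mul_log.continuousAt.mul (continuousAt_dslope_same.2 hd)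
  convert h using 1
  ext x
  by_cases hx : x = 0
  · simp [hx]
  · simp only [Pi.mul_apply, dslope_of_ne _ hx, slope_def_field]
    simp
    field_simp

theorem continuous_log_mul_log_one_sub_at_one :
    ContinuousAt (fun x : ℝ => Real.log x * Real.log (1 - x)) 1 := by
  have h : ContinuousAt ((fun x : ℝ => Real.log x * Real.log (1 - x)) ∘ fun x => 1 - x) 1 :=
    ContinuousAt.comp (by simpa using continuous_log_mul_log_one_sub_at_zero) (by fun_prop)
  convert h using 1
  ext x
  simp [mul_comm]

theorem continuous_log_mul_log_one_sub :
    Continuous fun x : ℝ => Real.log x * Real.log (1 - x) := by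
  refine continuous_iff_continuousAt.2 fun x => ?_
  by_cases h0 : x = 0
  · exact h0 ▸ continuous_log_mul_log_one_sub_at_zero
  by_cases h1 : x = 1
  · exact h1 ▸ continuous_log_mul_log_one_sub_at_one
  exact (Real.continuousAt_log h0).mul
    (ContinuousAt.log (by fun_prop) (sub_ne_zero.2 (Ne.symm h1)))

theorem continuousOn_rogersL : ContinuousOn rogersL (Icc 0 1) := by
  have h : ContinuousOn (fun x : ℝ => ∑' n : ℕ, x ^ (n + 1) / ((n : ℝ) + 1) ^ 2) (Icc 0 1) := by
    refine continuousOn_tsum (fun n => by fun_prop) summable_one_div_succ_sq fun n x hx => ?_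
    rw [Real.norm_of_nonneg (div_nonneg (pow_nonneg hx.1 _) (by positivity))]
    gcongr
    exact pow_le_one₀ hx.1 hx.2
  exact (h.add (continuous_log_mul_log_one_sub.continuousOn.const_mul (1 / 2))).congr
    fun x _ => rogersL_eq x

theorem hasDerivAt_tsum_pow_div_sq {x : ℝ} (hx : x ∈ Ioo (0 : ℝ) 1) :
    HasDerivAt (fun x : ℝ => ∑' n : ℕ, x ^ (n + 1) / ((n : ℝ) + 1) ^ 2)
      (-Real.log (1 - x) / x) x := by
  obtain ⟨ρ, hxρ, hρ⟩ := exists_between hx.2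
  have hρ0 : 0 < ρ := hx.1.trans hxρ
  have key := hasDerivAt_tsum_of_isPreconnected (𝕜 := ℝ)
    (g := fun (n : ℕ) (x : ℝ) => x ^ (n + 1) / ((n : ℝ) + 1) ^ 2)
    (g' := fun (n : ℕ) (x : ℝ) => x ^ n / ((n : ℝ) + 1)) (u := fun n => ρ ^ n)
    (t := Ioo 0 ρ) (y₀ := x) (y := x)
    (summable_geometric_of_lt_one hρ0.le hρ) isOpen_Ioo isPreconnected_Ioo
    (fun n y _ => by
      refine ((hasDerivAt_pow (n + 1) y).div_const (((n : ℝ) + 1) ^ 2)).congr_deriv ?_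
      push_cast [Nat.add_sub_cancel]
      field_simp)
    (fun n y hy => by
      rw [Real.norm_of_nonneg (div_nonneg (pow_nonneg hy.1.le _) (by positivity))]
      calc y ^ n / ((n : ℝ) + 1) ≤ y ^ n :=
            div_le_self (pow_nonneg hy.1.le _) (by linarith [n.cast_nonneg (α := ℝ)])
        _ ≤ ρ ^ n := pow_le_pow_left₀ hy.1.le hy.2.le n)
    ⟨hx.1, hxρ⟩
    (Summable.of_nonneg_of_le (fun n => div_nonneg (pow_nonneg hx.1.le _) (by positivity))
      (fun n => by gcongr; exact pow_le_one₀ hx.1.le hx.2.le) summable_one_div_succ_sq)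
    ⟨hx.1, hxρ⟩
  suffices e : -Real.log (1 - x) / x = ∑' n : ℕ, x ^ n / ((n : ℝ) + 1) by rwa [e]
  have h := Real.hasSum_pow_div_log_of_abs_lt_one (x := x) (by rw [abs_of_pos hx.1]; exact hx.2)
  rw [← (h.div_const x).tsum_eq]
  refine tsum_congr fun n => ?_
  have := hx.1.ne'
  field_simp
  ring

theorem hasDerivAt_rogersL {x : ℝ} (hx : x ∈ Ioo (0 : ℝ) 1) :
    HasDerivAt rogersL (-(1 / 2) * (Real.log (1 - x) / x + Real.log x / (1 - x))) x := by
  have h0 : x ≠ 0 := hx.1.ne'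
  have h1 : 1 - x ≠ 0 := (sub_pos.2 hx.2).ne'
  have hlog : HasDerivAt (fun x : ℝ => Real.log (1 - x)) (-1 / (1 - x)) x :=
    ((hasDerivAt_id x).const_sub 1).log h1
  have h := (hasDerivAt_tsum_pow_div_sq hx).add
    (((Real.hasDerivAt_log h0).mul hlog).const_mul (1 / 2))
  rw [funext rogersL_eq]
  refine h.congr_deriv ?_
  field_simp
  ring

theorem eq_of_hasDerivAt_zero {f : ℝ → ℝ} {a b : ℝ} (hab : a < b)
    (hc : ContinuousOn f (Icc a b)) (hd : ∀ x ∈ Ioo a b, HasDerivAt f 0 x) : f b = f a := by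
  obtain ⟨c, -, h⟩ := exists_hasDerivAt_eq_slope f (fun _ => 0) hab hc hd
  have : b - a ≠ 0 := (sub_pos.2 hab).ne'
  field_simp at h
  linarith

theorem rogersL_zero : rogersL 0 = 0 := by simp [rogersL]

theorem rogersL_one : rogersL 1 = Real.pi ^ 2 / 6 := by simp [rogersL]

/-- Euler's reflection formula. -/
theorem rogersL_add_rogersL_one_sub {x : ℝ} (hx : x ∈ Ioo (0 : ℝ) 1) :
    rogersL x + rogersL (1 - x) = Real.pi ^ 2 / 6 := by
  have h := eq_of_hasDerivAt_zero (f := fun x => rogersL x + rogersL (1 - x)) hx.1 ?_ ?_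
  · simpa [rogersL_zero, rogersL_one] using h
  · refine (continuousOn_rogersL.mono (Icc_subset_Icc_right hx.2.le)).add
      (continuousOn_rogersL.comp (by fun_prop) fun t ht => ?_)
    exact ⟨by linarith [ht.2, hx.2], by linarith [ht.1]⟩
  · intro t ht
    have ht1 : t < 1 := ht.2.trans hx.2
    have h2 : HasDerivAt (fun t => rogersL (1 - t)) _ t :=
      (hasDerivAt_rogersL (x := 1 - t) ⟨by linarith, by linarith [ht.1]⟩).comp t
        ((hasDerivAt_id t).const_sub 1)
    refine ((hasDerivAt_rogersL ⟨ht.1, ht1⟩).add h2).congr_deriv ?_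
    rw [sub_sub_cancel]
    ring

/-- Abel's five-term relation. -/
theorem rogersL_add_rogersL {x y : ℝ} (hx : x ∈ Ioo (0 : ℝ) 1) (hy : y ∈ Ioo (0 : ℝ) 1) :
    rogersL x + rogersL y = rogersL (x * y) + rogersL (x * (1 - y) / (1 - x * y)) +
      rogersL (y * (1 - x) / (1 - x * y)) := by
  have hy1 : 0 < 1 - y := sub_pos.2 hy.2
  have hpos : ∀ t ∈ Icc 0 x, 0 < 1 - t * y := fun t ht => by
    nlinarith [ht.1, ht.2, hx.2, hy.1, hy.2]
  have h := eq_of_hasDerivAt_zero (f := fun x => rogersL x + rogersL y - (rogersL (x * y) +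
    rogersL (x * (1 - y) / (1 - x * y)) + rogersL (y * (1 - x) / (1 - x * y)))) hx.1 ?_ ?_
  · simp [rogersL_zero] at h
    linarith
  · have h1 : ContinuousOn rogersL (Icc 0 x) :=
      continuousOn_rogersL.mono (Icc_subset_Icc_right hx.2.le)
    refine (h1.add continuousOn_const).sub (((continuousOn_rogersL.comp (by fun_prop) ?_).add
      (continuousOn_rogersL.comp (ContinuousOn.div (by fun_prop) (by fun_prop)
        fun t ht => (hpos t ht).ne') ?_)).add
      (continuousOn_rogersL.comp (ContinuousOn.div (by fun_prop) (by fun_prop)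
        fun t ht => (hpos t ht).ne') ?_))
    all_goals
      intro t ht
      have hp := hpos t ht
      have ht1 : 0 < 1 - t := by linarith [ht.2, hx.2]
      have hty := mul_nonneg ht.1 hy.1.le
    · exact ⟨hty, by linarith⟩
    · exact ⟨div_nonneg (mul_nonneg ht.1 hy1.le) hp.le, (div_le_one hp).2 (by nlinarith)⟩
    · exact ⟨div_nonneg (mul_nonneg hy.1.le ht1.le) hp.le, (div_le_one hp).2 (by nlinarith)⟩
  · intro t ht
    have hp := hpos t ⟨ht.1.le, ht.2.le⟩
    have ht0 : 0 < t := ht.1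
    have hy0 : 0 < y := hy.1
    have ht1 : 0 < 1 - t := by linarith [ht.2, hx.2]
    have hty := mul_pos ht0 hy0
    have hne := hp.ne'
    have eu : 1 - t * (1 - y) / (1 - t * y) = (1 - t) / (1 - t * y) := by field_simp; ring
    have ev : 1 - y * (1 - t) / (1 - t * y) = (1 - y) / (1 - t * y) := by
      rw [eq_div_iff hne, sub_mul, div_mul_cancel₀ _ hne]
      ring
    have hu : t * (1 - y) / (1 - t * y) ∈ Ioo (0 : ℝ) 1 :=
      ⟨by positivity, (div_lt_one hp).2 (by nlinarith)⟩
    have hv : y * (1 - t) / (1 - t * y) ∈ Ioo (0 : ℝ) 1 :=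
      ⟨by positivity, (div_lt_one hp).2 (by nlinarith)⟩
    have dm : HasDerivAt (fun t => t * y) y t := by
      simpa using (hasDerivAt_id t).mul_const y
    have dd : HasDerivAt (fun t => 1 - t * y) (-y) t := dm.const_sub 1
    have du : HasDerivAt (fun t => t * (1 - y) / (1 - t * y)) ((1 - y) / (1 - t * y) ^ 2) t := by
      refine (((hasDerivAt_id t).mul_const (1 - y)).div dd hne).congr_deriv ?_
      simp only [id]
      ring
    have dv : HasDerivAt (fun t => y * (1 - t) / (1 - t * y))
        (-(y * (1 - y)) / (1 - t * y) ^ 2) t := by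
      refine ((((hasDerivAt_id t).const_sub 1).const_mul y).div dd hne).congr_deriv ?_
      simp only [id]
      ring
    have hm : t * y ∈ Ioo (0 : ℝ) 1 := ⟨hty, by linarith⟩
    have Lm : HasDerivAt (fun t => rogersL (t * y)) _ t :=
      HasDerivAt.comp (h₂ := rogersL) (h := fun t => t * y) t (hasDerivAt_rogersL hm) dm
    have Lu : HasDerivAt (fun t => rogersL (t * (1 - y) / (1 - t * y))) _ t :=
      HasDerivAt.comp (h₂ := rogersL) (h := fun t => t * (1 - y) / (1 - t * y)) t
        (hasDerivAt_rogersL hu) du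
    have Lv : HasDerivAt (fun t => rogersL (y * (1 - t) / (1 - t * y))) _ t :=
      HasDerivAt.comp (h₂ := rogersL) (h := fun t => y * (1 - t) / (1 - t * y)) t
        (hasDerivAt_rogersL hv) dv
    refine (((hasDerivAt_rogersL ⟨ht0, by linarith⟩).add_const (rogersL y)).sub
      ((Lm.add Lu).add Lv)).congr_deriv ?_
    rw [eu, ev, Real.log_div (by positivity) hp.ne', Real.log_div (by positivity) hp.ne',
      Real.log_div (by positivity) hp.ne', Real.log_div (by positivity) hp.ne',
      Real.log_mul ht0.ne' hy1.ne', Real.log_mul hy0.ne' ht1.ne', Real.log_mul ht0.ne' hy0.ne']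
    field_simp
    ring

theorem rogersL_nonneg {x : ℝ} (hx : x ∈ Icc (0 : ℝ) 1) : 0 ≤ rogersL x := by
  rw [rogersL_eq]
  refine add_nonneg (tsum_nonneg fun n => div_nonneg (pow_nonneg hx.1 _) (by positivity)) ?_
  have := mul_nonneg_of_nonpos_of_nonpos (Real.log_nonpos hx.1 hx.2)
    (Real.log_nonpos (sub_nonneg.2 hx.2) (by linarith [hx.1] : 1 - x ≤ 1))
  linarith

theorem hasSum_rogersL_geometric {r : ℝ} (hr : r ∈ Ioo (0 : ℝ) 1) :
    HasSum (fun n : ℕ => rogersL ((1 - r) ^ 2 * r ^ (n + 1) / (1 - r ^ (n + 2)) ^ 2))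
      (rogersL r) := by
  have hr0 : 0 < r := hr.1
  have hr1 : 0 < 1 - r := sub_pos.2 hr.2
  have hpos : ∀ n : ℕ, 0 < 1 - r ^ (n + 1) := fun n =>
    sub_pos.2 (pow_lt_one₀ hr0.le hr.2 n.succ_ne_zero)
  set X : ℕ → ℝ := fun n => (1 - r) / (1 - r ^ (n + 2)) with hX
  set Y : ℕ → ℝ := fun n => r ^ (n + 1) * (1 - r) / (1 - r ^ (n + 2)) with hY
  have hXm : ∀ n, X n ∈ Ioo (0 : ℝ) 1 := fun n => by
    have h2 := hpos (n + 1)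
    have h1 := mul_pos hr0 (hpos n)
    refine ⟨div_pos hr1 h2, (div_lt_one h2).2 ?_⟩
    have : r ^ (n + 2) = r * r ^ (n + 1) := by ring
    linarith
  have hYm : ∀ n, Y n ∈ Ioo (0 : ℝ) 1 := fun n => by
    have h2 := hpos (n + 1)
    have h1 := hpos n
    refine ⟨div_pos (by positivity) h2, (div_lt_one h2).2 ?_⟩
    have : r ^ (n + 2) = r * r ^ (n + 1) := by ring
    linarith
  have hXY : ∀ n, (1 - r) ^ 2 * r ^ (n + 1) / (1 - r ^ (n + 2)) ^ 2 = X n * Y n := fun n => by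
    simp only [hX, hY, div_mul_div_comm]
    congr 1 <;> ring
  have hstep : ∀ n, rogersL (X n * Y n) =
      (rogersL (X n) + rogersL (Y n)) - (rogersL (X (n + 1)) + rogersL (Y (n + 1))) := fun n => by
    have h1 := (hpos n).ne'
    have h2 := (hpos (n + 1)).ne'
    have h3 := (hpos (n + 2)).ne'
    have e : 1 - X n * Y n =
        (1 - r ^ (n + 1)) * (1 - r ^ (n + 3)) / (1 - r ^ (n + 2)) ^ 2 := by
      simp only [hX, hY]
      field_simp
      ring
    have ex : X n * (1 - Y n) / (1 - X n * Y n) = X (n + 1) := by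
      have : 1 - Y n = (1 - r ^ (n + 1)) / (1 - r ^ (n + 2)) := by
        simp only [hY]
        field_simp
        ring
      rw [e, this]
      simp only [hX]
      field_simp
    have ey : Y n * (1 - X n) / (1 - X n * Y n) = Y (n + 1) := by
      have : 1 - X n = r * (1 - r ^ (n + 1)) / (1 - r ^ (n + 2)) := by
        simp only [hX]
        field_simp
        ring
      rw [e, this]
      simp only [hY]
      field_simp
      ring
    have := rogersL_add_rogersL (hXm n) (hYm n)
    rw [ex, ey] at this
    linarith
  simp only [hXY]
  rw [hasSum_iff_tendsto_nat_of_nonneg fun n => rogersL_nonneg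
    ⟨(mul_pos (hXm n).1 (hYm n).1).le, mul_le_one₀ (hXm n).2.le (hYm n).1.le (hYm n).2.le⟩]
  simp only [hstep, Finset.sum_range_sub' fun n => rogersL (X n) + rogersL (Y n)]
  have hpow : ∀ k, Tendsto (fun n : ℕ => r ^ (n + k)) atTop (𝓝 0) := fun k =>
    (tendsto_add_atTop_iff_nat k).2 (tendsto_pow_atTop_nhds_zero_of_lt_one hr0.le hr.2)
  have hden : Tendsto (fun n : ℕ => 1 - r ^ (n + 2)) atTop (𝓝 1) := by
    simpa using (hpow 2).const_sub 1
  have tX : Tendsto X atTop (𝓝 (1 - r)) := by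
    have h := (tendsto_const_nhds (x := 1 - r)).div hden one_ne_zero
    rwa [div_one] at h
  have tY : Tendsto Y atTop (𝓝 0) := by
    have h := ((hpow 1).mul_const (1 - r)).div hden one_ne_zero
    rwa [zero_mul, zero_div] at h
  have lift : ∀ {u : ℕ → ℝ} {l : ℝ}, (∀ n, u n ∈ Ioo (0 : ℝ) 1) → l ∈ Icc (0 : ℝ) 1 →
      Tendsto u atTop (𝓝 l) → Tendsto (fun n => rogersL (u n)) atTop (𝓝 (rogersL l)) :=
    fun hu hl ht => (continuousOn_rogersL _ hl).tendsto.comp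
      (tendsto_nhdsWithin_iff.2 ⟨ht, Eventually.of_forall fun n => Ioo_subset_Icc_self (hu n)⟩)
  have hlim := ((lift hXm ⟨hr1.le, by linarith⟩ tX).add
    (lift hYm ⟨le_rfl, zero_le_one⟩ tY)).const_sub (rogersL (X 0) + rogersL (Y 0))
  have hY0 : Y 0 = 1 - X 0 := by
    have := (hpos 1).ne'
    simp only [hX, hY]
    field_simp
    ring
  convert hlim using 2
  rw [hY0, rogersL_add_rogersL_one_sub (hXm 0), rogersL_zero, ← rogersL_add_rogersL_one_sub hr]
  ring

theorem stmt_6 (a : ℝ) (ha : a ∈ Set.Ioo (0 : ℝ) 1) :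
    ∑' n : ℕ, rogersL (a ^ 2 * (1 / 2 - a / 2) ^ (n + 1) * (1 / 2 + a / 2) ^ (n + 1) /
        ((1 / 2 + a / 2) ^ (n + 2) - (1 / 2 - a / 2) ^ (n + 2)) ^ 2) =
      rogersL ((1 - a) / (1 + a)) := by
  have ha0 : 0 < a := ha.1
  have ha1 : 0 < 1 - a := sub_pos.2 ha.2
  have hr : (1 - a) / (1 + a) ∈ Ioo (0 : ℝ) 1 :=
    ⟨by positivity, (div_lt_one (by positivity)).2 (by linarith)⟩
  rw [← (hasSum_rogersL_geometric hr).tsum_eq]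
  refine tsum_congr fun n => congrArg rogersL ?_
  obtain ⟨p, hp⟩ : ∃ p, p = 1 / 2 + a / 2 := ⟨_, rfl⟩
  obtain ⟨r, hr'⟩ : ∃ r, r = (1 - a) / (1 + a) := ⟨_, rfl⟩
  have hp0 : 0 < p := by rw [hp]; positivity
  have hq : 1 / 2 - a / 2 = r * p := by
    rw [hp, hr']
    field_simp
  have ha' : a = (1 - r) * p := by
    linarith
  rw [← hr'] at hr ⊢
  have hden : 1 - r ^ (n + 2) ≠ 0 :=
    (sub_pos.2 (pow_lt_one₀ hr.1.le hr.2 (n + 1).succ_ne_zero)).ne'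
  have hdiff : p ^ (n + 2) - (r * p) ^ (n + 2) = p ^ (n + 2) * (1 - r ^ (n + 2)) := by
    rw [mul_pow]
    ring
  rw [hq, ← hp, hdiff, ha']
  field_simp
  ring
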